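/- Let d ≥ 1, let β > 0 be a non-integer, N = ⌈β⌉ the smallest integer strictly greater than β, K ∈ K(N), and (h_n)_{n≥1} ∈ H. Then a bounded measurable 1-periodic f : ℝ^d → ℝ satisfies sup_{n≥1} h_n^{-β} ‖K_{h_n} * f - f‖_∞ < ∞ if and only if f coincides almost everywhere with a function of the Hölder class Σ(β). -/

import Mathlib

open MeasureTheory Real ENNReal

noncomputable section

/-- The rescaled kernel `K_h(t) = h^{-d} K(t/h)`. -/
def resKer (d : ℕ) (K : EuclideanSpace ℝ (Fin d) → ℝ) (h : ℝ) :
    EuclideanSpace ℝ (Fin d) → ℝ :=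
  fun t => (h ^ d)⁻¹ * K (h⁻¹ • t)

/-- Convolution `(g * f)(t) = ∫ g(t-u) f(u) du` on `ℝ^d`. -/
def convol (d : ℕ) (g f : EuclideanSpace ℝ (Fin d) → ℝ) :
    EuclideanSpace ℝ (Fin d) → ℝ :=
  fun t => ∫ u, g (t - u) * f u

/-- The sup-norm `‖f‖_∞` (essential supremum of `|f|` over `ℝ^d`), with values in `ℝ≥0∞`. -/
def supNorm (d : ℕ) (f : EuclideanSpace ℝ (Fin d) → ℝ) : ℝ≥0∞ :=
  eLpNorm f ⊤ volume

/-- `f` is 1-periodic: `f(x + e_i) = f(x)` for every standard basis vector `e_i`. -/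
def Per1 (d : ℕ) (f : EuclideanSpace ℝ (Fin d) → ℝ) : Prop :=
  ∀ x (i : Fin d), f (x + EuclideanSpace.single i 1) = f x

/-- `f` is bounded and measurable. -/
def BddMeas (d : ℕ) (f : EuclideanSpace ℝ (Fin d) → ℝ) : Prop :=
  Measurable f ∧ ∃ M, ∀ x, |f x| ≤ M

/-- The partial derivative `∂f/∂t_i`. -/
def pderiv1 (d : ℕ) (i : Fin d) (f : EuclideanSpace ℝ (Fin d) → ℝ) :
    EuclideanSpace ℝ (Fin d) → ℝ :=
  fun x => fderiv ℝ f x (EuclideanSpace.single i 1)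

/-- The partial derivative `∂^α f = ∂^{α_1}_{t_1} ⋯ ∂^{α_d}_{t_d} f` for a multi-index `α`. -/
def pderivM (d : ℕ) (α : Fin d → ℕ) (f : EuclideanSpace ℝ (Fin d) → ℝ) :
    EuclideanSpace ℝ (Fin d) → ℝ :=
  (List.finRange d).foldr (fun i g => (pderiv1 d i)^[α i] g) f

/-- The kernel class `K(N)`: conditions (A1)–(A6) of the paper. -/
def KernelClass (d N : ℕ) (K : EuclideanSpace ℝ (Fin d) → ℝ) : Prop :=
  -- (A1) compact support
  HasCompactSupport K ∧
  -- (A2) square-integrable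
  Integrable (fun u => K u ^ 2) ∧
  -- (A3) L² increment bound
  (∃ C > 0, ∃ γ ∈ Set.Ioc (0 : ℝ) 1, ∀ t : EuclideanSpace ℝ (Fin d), ‖t‖ ≤ 1 →
    ∫ u, (K (t + u) - K u) ^ 2 ≤ C * ‖t‖ ^ (2 * γ)) ∧
  -- (A4) unit mass
  (∫ u, K u) = 1 ∧
  -- (A5) smoothness and integrable partial derivatives up to order N
  (ContDiff ℝ N K ∧ ∀ α : Fin d → ℕ, (∑ i, α i) ≤ N →
    Integrable (fun t => |pderivM d α K t|)) ∧
  -- (A6) vanishing moments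
  (∀ α : Fin d → ℕ, 1 ≤ (∑ i, α i) → (∑ i, α i) ≤ N →
    ∫ u, (∏ i, u i ^ α i) * K u = 0)

/-- The bandwidth class `H`: `h_n = 2^{-m_n}` with `(m_n)` nondecreasing positive integers
tending to `∞` and with bounded increments. -/
def BandClass (h : ℕ → ℝ) : Prop :=
  ∃ m : ℕ → ℕ, (∀ n, 0 < m n) ∧ Monotone m ∧
    Filter.Tendsto m Filter.atTop Filter.atTop ∧
    (∃ B : ℕ, ∀ n, m (n + 1) - m n ≤ B) ∧
    ∀ n, h n = (2 : ℝ) ^ (-(m n : ℝ))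

/-- `f` belongs to the Besov space `B^β_{∞,∞}` in the approximation sense: there are bounded
1-periodic `C^N` functions `f_j` with `sup_j 2^{jβ} ‖f - f_j‖_∞ < ∞` and
`sup_j 2^{-(N-β)j} ‖∂^α f_j‖_∞ < ∞` for every multi-index `α` with `|α| = N`. -/
def MemBesov (d : ℕ) (β : ℝ) (N : ℕ) (f : EuclideanSpace ℝ (Fin d) → ℝ) : Prop :=
  ∃ fs : ℕ → EuclideanSpace ℝ (Fin d) → ℝ,
    (∀ j, 1 ≤ j → (∃ M, ∀ x, |fs j x| ≤ M) ∧ Per1 d (fs j) ∧ ContDiff ℝ N (fs j)) ∧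
    (∃ C : ℝ, ∀ j : ℕ, 1 ≤ j →
      supNorm d (fun x => f x - fs j x) ≤ ENNReal.ofReal (C * 2 ^ (-(j : ℝ) * β))) ∧
    (∃ C : ℝ, ∀ α : Fin d → ℕ, (∑ i, α i) = N → ∀ j : ℕ, 1 ≤ j →
      supNorm d (pderivM d α (fs j)) ≤ ENNReal.ofReal (C * 2 ^ (((N : ℝ) - β) * j)))

/-- The Hölder class `Σ(β)`: `f` is a bounded 1-periodic function of class `C^m`
(`m` the largest integer strictly less than `β`) all of whose partial derivatives of order `m`
are `(β-m)`-Hölder. -/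
def HolderSigma (d : ℕ) (β : ℝ) (f : EuclideanSpace ℝ (Fin d) → ℝ) : Prop :=
  ∃ m : ℕ, (m : ℝ) < β ∧ β ≤ (m : ℝ) + 1 ∧
    ContDiff ℝ m f ∧ (∃ M, ∀ x, |f x| ≤ M) ∧ Per1 d f ∧
    ∀ σ : Fin d → ℕ, (∑ i, σ i) = m → ∃ C : ℝ, ∀ x y,
      |pderivM d σ f x - pderivM d σ f y| ≤ C * ‖x - y‖ ^ (β - (m : ℝ))

end

/-- The iterated partial derivative along a multi-index as a list fold. -/
theorem pderivM_eq_foldr (d : ℕ) (σ : Fin d → ℕ) (g : EuclideanSpace ℝ (Fin d) → ℝ) :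
    pderivM d σ g =
      ((List.finRange d).flatMap fun i => List.replicate (σ i) i).foldr (pderiv1 d) g := by
  unfold pderivM
  induction List.finRange d with
  | nil => rfl
  | cons a l ih =>
    have key : ∀ (k : ℕ) (u : EuclideanSpace ℝ (Fin d) → ℝ),
        (List.replicate k a).foldr (pderiv1 d) u = (pderiv1 d a)^[k] u := by
      intro k u
      induction k with
      | zero => rfl
      | succ k ihk => rw [List.replicate_succ, List.foldr_cons, ihk, Function.iterate_succ_apply']
    rw [List.foldr_cons, ih, List.flatMap_cons, List.foldr_append, key]

theorem length_flatMap_replicate (d : ℕ) (σ : Fin d → ℕ) :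
    ((List.finRange d).flatMap fun i => List.replicate (σ i) i).length = ∑ i, σ i := by
  simp [List.length_flatMap, Fin.sum_univ_def]

/-- Successive partial derivatives are values of the iterated Fréchet derivative. -/
theorem foldr_pderiv1_apply (d : ℕ) (l : List (Fin d)) (g : EuclideanSpace ℝ (Fin d) → ℝ)
    (hg : ContDiff ℝ l.length g) (x : EuclideanSpace ℝ (Fin d)) :
    l.foldr (pderiv1 d) g x =
      iteratedFDeriv ℝ l.length g x (fun j => EuclideanSpace.single (l.get j) 1) := by
  induction l generalizing x with
  | nil => simp
  | cons a l ih =>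
    have hg' : ContDiff ℝ l.length g := hg.of_le (by simp)
    have hfun : l.foldr (pderiv1 d) g = fun y =>
        iteratedFDeriv ℝ l.length g y (fun j => EuclideanSpace.single (l.get j) 1) :=
      funext (ih hg')
    have hdiff : DifferentiableAt ℝ (iteratedFDeriv ℝ l.length g) x :=
      hg.contDiffAt.differentiableAt_iteratedFDeriv (by norm_cast; simp)
    rw [List.foldr_cons, hfun]
    change fderiv ℝ (fun y => iteratedFDeriv ℝ l.length g y
      (fun j => EuclideanSpace.single (l.get j) 1)) x (EuclideanSpace.single a 1) = _
    exact (hdiff.iteratedFDeriv_succ_apply_left'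
      (m := fun j : Fin (l.length + 1) =>
        EuclideanSpace.single ((a :: l).get j) (1 : ℝ))).symm

theorem contDiff_pderiv1 (d : ℕ) (a : Fin d) (n : ℕ) (g : EuclideanSpace ℝ (Fin d) → ℝ)
    (hg : ContDiff ℝ (n + 1 : ℕ) g) : ContDiff ℝ n (pderiv1 d a g) :=
  (hg.fderiv_right (m := n) (by norm_cast)).clm_apply contDiff_const

theorem contDiff_foldr_pderiv1 (d : ℕ) (l : List (Fin d)) (n : ℕ)
    (g : EuclideanSpace ℝ (Fin d) → ℝ) (hg : ContDiff ℝ (n + l.length : ℕ) g) :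
    ContDiff ℝ n (l.foldr (pderiv1 d) g) := by
  induction l generalizing n with
  | nil => simpa using hg
  | cons a l ih =>
    refine contDiff_pderiv1 d a n _ (ih (n + 1) ?_)
    convert hg using 2
    simp only [List.length_cons]
    ring

theorem pderiv1_comm (d : ℕ) (a b : Fin d) (g : EuclideanSpace ℝ (Fin d) → ℝ)
    (hg : ContDiff ℝ 2 g) : pderiv1 d a (pderiv1 d b g) = pderiv1 d b (pderiv1 d a g) := by
  have hd : Differentiable ℝ (fderiv ℝ g) :=
    (hg.fderiv_right (m := 1) (by norm_num)).differentiable (by norm_num)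
  have key : ∀ (a b : Fin d) x, pderiv1 d a (pderiv1 d b g) x =
      fderiv ℝ (fderiv ℝ g) x (EuclideanSpace.single a 1) (EuclideanSpace.single b 1) := by
    intro a b x
    unfold pderiv1
    rw [fderiv_clm_apply (hd x) (differentiableAt_const _)]
    simp
  funext x
  rw [key, key]
  exact second_derivative_symmetric (f := g) (f' := fderiv ℝ g)
    (fun y => (hg.differentiable (by norm_num) y).hasFDerivAt) (hd x).hasFDerivAt _ _

theorem foldr_pderiv1_perm (d : ℕ) {l₁ l₂ : List (Fin d)} (hl : l₁.Perm l₂)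
    (g : EuclideanSpace ℝ (Fin d) → ℝ) (hg : ContDiff ℝ l₁.length g) :
    l₁.foldr (pderiv1 d) g = l₂.foldr (pderiv1 d) g := by
  induction hl with
  | nil => rfl
  | cons a _ ih =>
    rw [List.foldr_cons, List.foldr_cons, ih (hg.of_le (by simp))]
  | swap a b l =>
    simp only [List.foldr_cons]
    refine pderiv1_comm d _ _ _ (contDiff_foldr_pderiv1 d l 2 g ?_)
    convert hg using 2
    simp only [List.length_cons]
    ring
  | trans h₁ h₂ ih₁ ih₂ =>
    rw [ih₁ hg, ih₂ (by rwa [h₁.length_eq] at hg)]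

/-- Each mixed partial derivative is a value of the iterated Fréchet derivative on unit
vectors. -/
theorem pderivM_eq_iteratedFDeriv (d m : ℕ) (σ : Fin d → ℕ) (hσ : ∑ i, σ i = m)
    (g : EuclideanSpace ℝ (Fin d) → ℝ) (hg : ContDiff ℝ m g) :
    ∃ r : Fin m → Fin d, ∀ x, pderivM d σ g x =
      iteratedFDeriv ℝ m g x (fun j => EuclideanSpace.single (r j) 1) := by
  have hlen := length_flatMap_replicate d σ
  rw [pderivM_eq_foldr]
  generalize ((List.finRange d).flatMap fun i => List.replicate (σ i) i) = l at hlen ⊢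
  rw [hσ] at hlen
  subst hlen
  exact ⟨l.get, foldr_pderiv1_apply d l g hg⟩

/-- Values of the iterated Fréchet derivative on basis vectors are mixed partial derivatives. -/
theorem iteratedFDeriv_eq_pderivM (d m : ℕ) (r : Fin m → Fin d)
    (g : EuclideanSpace ℝ (Fin d) → ℝ) (hg : ContDiff ℝ m g) :
    ∃ σ : Fin d → ℕ, ∑ i, σ i = m ∧ ∀ x,
      iteratedFDeriv ℝ m g x (fun j => EuclideanSpace.single (r j) 1) = pderivM d σ g x := by
  obtain ⟨l, hl, hr⟩ : ∃ l : List (Fin d), ∃ hl : l.length = m, ∀ j, r j = l.get (j.cast hl.symm) :=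
    ⟨List.ofFn r, by simp, by simp⟩
  subst hl
  obtain rfl : r = l.get := funext fun j => by simpa using hr j
  let σ : Fin d → ℕ := fun i => l.count i
  have hperm : l.Perm ((List.finRange d).flatMap fun i => List.replicate (σ i) i) := by
    rw [List.perm_iff_count]
    intro a
    rw [List.count_flatMap]
    have : (List.count a ∘ fun i => List.replicate (σ i) i) = fun i => if i = a then σ i else 0 := by
      funext i
      simp [List.count_replicate]
    rw [this, ← Fin.sum_univ_def]
    simp [σ]
  refine ⟨σ, ?_, fun x => ?_⟩
  · rw [← length_flatMap_replicate, ← hperm.length_eq]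
  · rw [pderivM_eq_foldr, ← foldr_pderiv1_perm d hperm g hg, foldr_pderiv1_apply d l g hg]

/-- Expansion of a multilinear form in the standard basis. -/
theorem multilinear_eq_sum_basis (d m : ℕ)
    (A : ContinuousMultilinearMap ℝ (fun _ : Fin m => EuclideanSpace ℝ (Fin d)) ℝ)
    (v : Fin m → EuclideanSpace ℝ (Fin d)) :
    A v = ∑ r : Fin m → Fin d,
      (∏ j, v j (r j)) * A (fun j => EuclideanSpace.single (r j) 1) := by
  have hv : v = fun j => ∑ i, v j i • EuclideanSpace.single i (1 : ℝ) := by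
    funext j
    conv_lhs => rw [← (EuclideanSpace.basisFun (Fin d) ℝ).sum_repr (v j)]
    simp
  conv_lhs => rw [hv]
  rw [A.map_sum]
  exact Finset.sum_congr rfl fun r _ => by
    rw [A.map_smul_univ (fun j => v j (r j)) (fun j => EuclideanSpace.single (r j) (1 : ℝ)),
      smul_eq_mul]

theorem multilinear_norm_le_sum_basis (d m : ℕ)
    (A : ContinuousMultilinearMap ℝ (fun _ : Fin m => EuclideanSpace ℝ (Fin d)) ℝ) :
    ‖A‖ ≤ ∑ r : Fin m → Fin d, |A (fun j => EuclideanSpace.single (r j) 1)| := by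
  refine A.opNorm_le_bound (Finset.sum_nonneg fun _ _ => abs_nonneg _) fun v => ?_
  rw [multilinear_eq_sum_basis d m A v, Finset.sum_mul]
  refine (norm_sum_le _ _).trans (Finset.sum_le_sum fun r _ => ?_)
  rw [norm_mul, mul_comm, norm_prod, Real.norm_eq_abs]
  gcongr with j _
  exact PiLp.norm_apply_le (v j) (r j)

/-- Hölder bounds on all partial derivatives of order `m` give a Hölder bound on the `m`-th
Fréchet derivative. -/
theorem holder_iteratedFDeriv_of_pderivM (d m : ℕ) (γ : ℝ) (g : EuclideanSpace ℝ (Fin d) → ℝ)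
    (hg : ContDiff ℝ m g)
    (hσ : ∀ σ : Fin d → ℕ, (∑ i, σ i) = m → ∃ C : ℝ, ∀ x y,
      |pderivM d σ g x - pderivM d σ g y| ≤ C * ‖x - y‖ ^ γ) :
    ∃ C : ℝ, ∀ x y, ‖iteratedFDeriv ℝ m g x - iteratedFDeriv ℝ m g y‖ ≤ C * ‖x - y‖ ^ γ := by
  have hr : ∀ r : Fin m → Fin d, ∃ C : ℝ, ∀ x y,
      |(iteratedFDeriv ℝ m g x - iteratedFDeriv ℝ m g y)
        (fun j => EuclideanSpace.single (r j) 1)| ≤ C * ‖x - y‖ ^ γ := by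
    intro r
    obtain ⟨σ, hs, h⟩ := iteratedFDeriv_eq_pderivM d m r g hg
    obtain ⟨C, hC⟩ := hσ σ hs
    refine ⟨C, fun x y => ?_⟩
    rw [sub_apply, h x, h y]
    exact hC x y
  choose C hC using hr
  refine ⟨∑ r, C r, fun x y => (multilinear_norm_le_sum_basis d m _).trans ?_⟩
  rw [Finset.sum_mul]
  exact Finset.sum_le_sum fun r _ => hC r x y

/-- Taylor expansion with a Hölder remainder. -/
theorem exists_taylor_holder_remainder {E : Type*} [NormedAddCommGroup E] [NormedSpace ℝ E]
    (m : ℕ) (γ : ℝ) (hγ : 0 ≤ γ) (g : E → ℝ) (hg : ContDiff ℝ m g) (C : ℝ)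
    (hC : ∀ x y, ‖iteratedFDeriv ℝ m g x - iteratedFDeriv ℝ m g y‖ ≤ C * ‖x - y‖ ^ γ) :
    ∃ (c : ℕ → ℝ) (C' : ℝ), ∀ x y, |g (x + y) - g x -
      ∑ k ∈ Finset.range m, c k * iteratedFDeriv ℝ (k + 1) g x (fun _ => y)| ≤
        C' * (‖y‖ ^ γ * ‖y‖ ^ m) := by
  rcases m with _ | n
  · refine ⟨0, C, fun x y => ?_⟩
    have h1 := hC (x + y) x
    have h2 := (iteratedFDeriv ℝ 0 g (x + y) - iteratedFDeriv ℝ 0 g x).le_opNorm (fun _ => x)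
    simp at h1 h2 ⊢
    linarith
  · let I : ℝ := ∫ t in (0 : ℝ)..1, (1 - t) ^ n
    let c : ℕ → ℝ := fun k => if k < n then ((k + 1).factorial : ℝ)⁻¹ else (n.factorial : ℝ)⁻¹ * I
    have hcont : ∀ x y : E, Continuous fun t : ℝ =>
        iteratedFDeriv ℝ (n + 1) g (x + t • y) (fun _ => y) := by
      intro x y
      have h1 : Continuous (iteratedFDeriv ℝ (n + 1) g) :=
        hg.continuous_iteratedFDeriv (by norm_cast)
      have h2 : Continuous fun t : ℝ => iteratedFDeriv ℝ (n + 1) g (x + t • y) :=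
        h1.comp (by fun_prop)
      exact h2.eval_const _
    have hC0 : ∀ x y : E, 0 ≤ C * ‖x - y‖ ^ γ := fun x y => (norm_nonneg _).trans (hC x y)
    refine ⟨c, (n.factorial : ℝ)⁻¹ * C, fun x y => ?_⟩
    have hT := map_add_eq_sum_add_integral_iteratedFDeriv (f := g) (x := x) (y := y) (n := n)
      (fun t _ => by exact_mod_cast hg.contDiffAt)
    have hsum : ∑ k ∈ Finset.range (n + 1), c k * iteratedFDeriv ℝ (k + 1) g x (fun _ => y) =
        ∑ k ∈ Finset.range n,
          ((k + 1).factorial : ℝ)⁻¹ * iteratedFDeriv ℝ (k + 1) g x (fun _ => y) +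
        (n.factorial : ℝ)⁻¹ * ∫ t in (0 : ℝ)..1,
          (1 - t) ^ n * iteratedFDeriv ℝ (n + 1) g x (fun _ => y) := by
      rw [Finset.sum_range_succ, intervalIntegral.integral_mul_const]
      congr 1
      · refine Finset.sum_congr rfl fun k hk => ?_
        simp [c, Finset.mem_range.1 hk]
      · simp [c, I, mul_assoc]
    rw [hsum, hT, Finset.sum_range_succ']
    have hrem : |∫ t in (0 : ℝ)..1, ((1 - t) ^ n * iteratedFDeriv ℝ (n + 1) g (x + t • y) (fun _ => y)
        - (1 - t) ^ n * iteratedFDeriv ℝ (n + 1) g x (fun _ => y))| ≤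
        C * (‖y‖ ^ γ * ‖y‖ ^ (n + 1)) := by
      have := intervalIntegral.norm_integral_le_of_norm_le_const (a := 0) (b := 1)
        (f := fun t => ((1 - t) ^ n * iteratedFDeriv ℝ (n + 1) g (x + t • y) (fun _ => y)
        - (1 - t) ^ n * iteratedFDeriv ℝ (n + 1) g x (fun _ => y)))
        (C := C * (‖y‖ ^ γ * ‖y‖ ^ (n + 1))) ?_
      · simpa using this
      intro t ht
      rw [Set.uIoc_of_le zero_le_one] at ht
      rw [← mul_sub, norm_mul, ← sub_apply]
      have hb : ‖(1 - t) ^ n‖ ≤ 1 := by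
        rw [norm_pow, Real.norm_eq_abs]
        exact pow_le_one₀ (abs_nonneg _) (abs_le.2 ⟨by linarith [ht.2], by linarith [ht.1]⟩)
      have h1 := (iteratedFDeriv ℝ (n + 1) g (x + t • y) -
        iteratedFDeriv ℝ (n + 1) g x).le_opNorm (fun _ => y)
      have h2 := hC (x + t • y) x
      have h3 : ‖x + t • y - x‖ ≤ ‖y‖ := by
        rw [add_sub_cancel_left, norm_smul, Real.norm_eq_abs, abs_of_pos ht.1]
        exact mul_le_of_le_one_left (norm_nonneg _) ht.2
      have h4 : C * ‖x + t • y - x‖ ^ γ ≤ C * ‖y‖ ^ γ := by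
        rcases eq_or_ne y 0 with rfl | hy
        · simp
        · have hC' : 0 ≤ C := by
            have := hC0 y 0
            rw [sub_zero] at this
            exact nonneg_of_mul_nonneg_left this (Real.rpow_pos_of_pos (norm_pos_iff.2 hy) _)
          gcongr
      simp only [Finset.prod_const, Finset.card_univ, Fintype.card_fin] at h1
      calc _ ≤ 1 * _ := mul_le_mul_of_nonneg_right hb (norm_nonneg _)
        _ ≤ ‖iteratedFDeriv ℝ (n + 1) g (x + t • y) -
            iteratedFDeriv ℝ (n + 1) g x‖ * ‖y‖ ^ (n + 1) := by rw [one_mul]; exact h1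
        _ ≤ (C * ‖y‖ ^ γ) * ‖y‖ ^ (n + 1) := by
            gcongr
            exact h2.trans h4
        _ = _ := by ring
    have hI₁ : Continuous fun t : ℝ =>
        (1 - t) ^ n * iteratedFDeriv ℝ (n + 1) g (x + t • y) (fun _ => y) :=
      (by fun_prop : Continuous fun t : ℝ => (1 - t) ^ n).mul (hcont x y)
    have hI₂ : Continuous fun t : ℝ =>
        (1 - t) ^ n * iteratedFDeriv ℝ (n + 1) g x (fun _ => y) := by fun_prop
    rw [intervalIntegral.integral_sub (hI₁.intervalIntegrable _ _)
      (hI₂.intervalIntegrable _ _)] at hrem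
    have hfac : (0 : ℝ) ≤ (n.factorial : ℝ)⁻¹ := by positivity
    have := mul_le_mul_of_nonneg_left hrem hfac
    rw [← abs_of_nonneg hfac, ← abs_mul, abs_of_nonneg hfac] at this
    rw [mul_assoc]
    refine le_trans (le_of_eq ?_) this
    congr 1
    simp only [smul_eq_mul, iteratedFDeriv_zero_apply, Nat.factorial_zero, Nat.cast_one, inv_one,
      one_mul]
    ring

/-- The kernel annihilates homogeneous forms of positive degree at most `N`. -/
theorem integral_kernel_mul_multilinear (d N k : ℕ) (hk : 1 ≤ k) (hkN : k ≤ N)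
    (K : EuclideanSpace ℝ (Fin d) → ℝ) (hcs : HasCompactSupport K) (hcont : Continuous K)
    (hmom : ∀ α : Fin d → ℕ, 1 ≤ (∑ i, α i) → (∑ i, α i) ≤ N →
      ∫ u, (∏ i, u i ^ α i) * K u = 0)
    (A : ContinuousMultilinearMap ℝ (fun _ : Fin k => EuclideanSpace ℝ (Fin d)) ℝ) :
    ∫ v, K v * A (fun _ => v) = 0 := by
  have hexp : ∀ v, K v * A (fun _ => v) = ∑ r : Fin k → Fin d,
      ((∏ j, v (r j)) * K v) * A (fun j => EuclideanSpace.single (r j) 1) := by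
    intro v
    rw [multilinear_eq_sum_basis d k A, Finset.mul_sum]
    exact Finset.sum_congr rfl fun r _ => by ring
  simp_rw [hexp]
  rw [integral_finsetSum]
  · refine Finset.sum_eq_zero fun r _ => ?_
    rw [integral_mul_const]
    have hprod : ∀ v : EuclideanSpace ℝ (Fin d), ∏ j, v (r j) =
        ∏ i, v i ^ (Finset.univ.filter fun j => r j = i).card := by
      intro v
      rw [← Finset.prod_fiberwise Finset.univ r]
      refine Finset.prod_congr rfl fun i _ => ?_
      rw [Finset.prod_congr rfl (g := fun _ => v i) (fun j hj => by rw [(Finset.mem_filter.1 hj).2]),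
        Finset.prod_const]
    have hcard : ∑ i, (Finset.univ.filter fun j => r j = i).card = k := by
      rw [← Finset.card_eq_sum_card_fiberwise (f := r) (t := Finset.univ) (by simp)]
      simp
    simp_rw [hprod]
    rw [hmom _ (by rw [hcard]; exact hk) (by rw [hcard]; exact hkN), zero_mul]
  · intro r _
    refine Integrable.mul_const (Continuous.integrable_of_hasCompactSupport ?_ hcs.mul_left) _
    fun_prop

theorem convol_resKer_eq (d : ℕ) (K f : EuclideanSpace ℝ (Fin d) → ℝ) (h : ℝ) (hh : 0 < h)
    (t : EuclideanSpace ℝ (Fin d)) :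
    convol d (resKer d K h) f t = ∫ v, K v * f (t - h • v) := by
  have h1 := integral_sub_left_eq_self (fun u => resKer d K h u * f (t - u)) volume t
  simp only [_root_.sub_sub_cancel] at h1
  unfold convol
  rw [h1]
  have h2 := Measure.integral_comp_smul (volume : Measure (EuclideanSpace ℝ (Fin d)))
    (fun u => K (h⁻¹ • u) * f (t - u)) h
  simp only [finrank_euclideanSpace, Fintype.card_fin, smul_smul, inv_mul_cancel₀ hh.ne',
    one_smul] at h2
  rw [h2, abs_of_pos (by positivity), smul_eq_mul, ← integral_const_mul]
  simp [resKer, mul_assoc]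

/-- A Hölder function is approximated at rate `h ^ β` by convolution with a kernel having
vanishing moments. -/
theorem supNorm_convol_sub_le (d N m : ℕ) (hmN : m ≤ N) (β : ℝ) (hm : (m : ℝ) < β)
    (K : EuclideanSpace ℝ (Fin d) → ℝ) (hcs : HasCompactSupport K) (hcont : Continuous K)
    (hmass : ∫ u, K u = 1)
    (hmom : ∀ α : Fin d → ℕ, 1 ≤ (∑ i, α i) → (∑ i, α i) ≤ N →
      ∫ u, (∏ i, u i ^ α i) * K u = 0)
    (f g : EuclideanSpace ℝ (Fin d) → ℝ) (hfg : f =ᵐ[volume] g) (hg : ContDiff ℝ m g)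
    (hσ : ∀ σ : Fin d → ℕ, (∑ i, σ i) = m → ∃ C : ℝ, ∀ x y,
      |pderivM d σ g x - pderivM d σ g y| ≤ C * ‖x - y‖ ^ (β - (m : ℝ))) :
    ∃ C : ℝ, ∀ h : ℝ, 0 < h →
      supNorm d (fun t => convol d (resKer d K h) f t - f t) ≤ ENNReal.ofReal (C * h ^ β) := by
  obtain ⟨C₀, hC₀⟩ := holder_iteratedFDeriv_of_pderivM d m _ g hg hσ
  obtain ⟨c, C, hC⟩ := exists_taylor_holder_remainder m (β - m) (by linarith) g hg C₀ hC₀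
  refine ⟨C * ∫ v, |K v| * (‖v‖ ^ (β - m) * ‖v‖ ^ m), fun h hh => ?_⟩
  unfold supNorm
  rw [eLpNorm_exponent_top]
  refine eLpNormEssSup_le_of_ae_bound ?_
  filter_upwards [hfg] with t ht
  have hc1 : convol d (resKer d K h) f t = convol d (resKer d K h) g t := by
    unfold convol
    refine integral_congr_ae ?_
    filter_upwards [hfg] with u hu
    rw [hu]
  have hgc : Continuous g := hg.continuous
  have hint : ∀ φ : EuclideanSpace ℝ (Fin d) → ℝ, Continuous φ → Integrable fun v => K v * φ v :=
    fun φ hφ => (hcont.mul hφ).integrable_of_hasCompactSupport hcs.mul_right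
  have hDc : ∀ k, Continuous fun v : EuclideanSpace ℝ (Fin d) =>
      iteratedFDeriv ℝ (k + 1) g t (fun _ => v) := fun k =>
    (iteratedFDeriv ℝ (k + 1) g t).cont.comp (by fun_prop)
  have hterm : ∀ v : EuclideanSpace ℝ (Fin d), ∀ k, iteratedFDeriv ℝ (k + 1) g t (fun _ => -(h • v)) =
      (-h) ^ (k + 1) * iteratedFDeriv ℝ (k + 1) g t (fun _ => v) := by
    intro v k
    have := (iteratedFDeriv ℝ (k + 1) g t).map_smul_univ (fun _ => -h) (fun _ => v)
    simpa using this
  have hzero : ∫ v, K v * ∑ k ∈ Finset.range m,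
      c k * iteratedFDeriv ℝ (k + 1) g t (fun _ => -(h • v)) = 0 := by
    simp_rw [hterm, Finset.mul_sum]
    rw [integral_finsetSum]
    · refine Finset.sum_eq_zero fun k hk => ?_
      have hk' := Finset.mem_range.1 hk
      have := integral_kernel_mul_multilinear d N (k + 1) (by omega) (by omega) K hcs hcont hmom
        (iteratedFDeriv ℝ (k + 1) g t)
      calc _ = ∫ v, (c k * (-h) ^ (k + 1)) *
            (K v * iteratedFDeriv ℝ (k + 1) g t (fun _ => v)) := by
            congr 1; funext v; ring
        _ = 0 := by rw [integral_const_mul, this, mul_zero]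
    · intro k _
      exact hint _ (((hDc k).const_mul _).const_mul _)
  have hsumc : Continuous fun v : EuclideanSpace ℝ (Fin d) => ∑ k ∈ Finset.range m,
      c k * iteratedFDeriv ℝ (k + 1) g t (fun _ => -(h • v)) := by
    simp_rw [hterm]
    exact continuous_finsetSum _ fun k _ => ((hDc k).const_mul _).const_mul _
  have hshift : Continuous fun v : EuclideanSpace ℝ (Fin d) => g (t - h • v) := by fun_prop
  have hmain : convol d (resKer d K h) f t - f t = ∫ v, K v * (g (t + -(h • v)) - g t -
      ∑ k ∈ Finset.range m, c k * iteratedFDeriv ℝ (k + 1) g t (fun _ => -(h • v))) := by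
    rw [hc1, convol_resKer_eq d K g h hh, ht]
    simp_rw [mul_sub, ← sub_eq_add_neg]
    have hdiff : Integrable fun v => K v * g (t - h • v) - K v * g t :=
      (hint _ hshift).sub (hint _ continuous_const)
    rw [integral_sub hdiff (hint _ hsumc), hzero,
      integral_sub (hint _ hshift) (hint _ continuous_const), integral_mul_const, hmass]
    ring
  rw [hmain, ← integral_const_mul, ← integral_mul_const]
  refine norm_integral_le_of_norm_le ?_ (Filter.Eventually.of_forall fun v => ?_)
  · refine (Integrable.const_mul ?_ _).mul_const _
    have hcr : Continuous fun v : EuclideanSpace ℝ (Fin d) => ‖v‖ ^ (β - m) * ‖v‖ ^ m :=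
      (continuous_norm.rpow_const fun _ => Or.inr (by linarith)).mul (by fun_prop)
    exact (hcont.abs.mul hcr).integrable_of_hasCompactSupport
      (HasCompactSupport.mul_right (hcs.comp_left (g := fun x : ℝ => |x|) abs_zero))
  · rw [norm_mul, Real.norm_eq_abs]
    calc |K v| * _ ≤ |K v| * (C * (‖-(h • v)‖ ^ (β - m) * ‖-(h • v)‖ ^ m)) := by
          gcongr
          exact hC t (-(h • v))
      _ = C * (|K v| * (‖v‖ ^ (β - m) * ‖v‖ ^ m)) * h ^ β := by
          rw [norm_neg, norm_smul, Real.norm_eq_abs, abs_of_pos hh,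
            Real.mul_rpow hh.le (norm_nonneg _), mul_pow]
          have : h ^ β = h ^ (β - m) * h ^ m := by
            rw [← Real.rpow_natCast h m, ← Real.rpow_add hh, sub_add_cancel]
          rw [this]
          ring

/-- Derivatives of the convolution of a smooth compactly supported function with an essentially
bounded one. -/
theorem norm_iteratedFDeriv_convolution_le.{u} {G F F' : Type u} [NormedAddCommGroup G]
    [NormedSpace ℝ G] [FiniteDimensional ℝ G] [MeasurableSpace G] [BorelSpace G]
    [NormedAddCommGroup F] [NormedSpace ℝ F] [NormedAddCommGroup F'] [NormedSpace ℝ F']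
    (μ : Measure G) [μ.IsAddHaarMeasure] (w : G → ℝ) (hw : LocallyIntegrable w μ) (M : ℝ)
    (hM : 0 ≤ M) (hwM : ∀ᵐ x ∂μ, |w x| ≤ M) (l : ℕ) (L : F →L[ℝ] ℝ →L[ℝ] F') (φ : G → F)
    (hc : HasCompactSupport φ) (hφ : ContDiff ℝ l φ) (x : G) :
    ‖iteratedFDeriv ℝ l (convolution φ w L μ) x‖ ≤
      ‖L‖ * M * ∫ t, ‖iteratedFDeriv ℝ l φ t‖ ∂μ := by
  induction l generalizing F F' with
  | zero =>
    simp only [norm_iteratedFDeriv_zero]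
    rw [← integral_const_mul]
    have hint : Integrable φ μ := hφ.continuous.integrable_of_hasCompactSupport hc
    refine norm_integral_le_of_norm_le (hint.norm.const_mul _) ?_
    filter_upwards [(quasiMeasurePreserving_sub_left μ x).ae hwM] with t ht
    calc ‖L (φ t) (w (x - t))‖ ≤ ‖L‖ * ‖φ t‖ * ‖w (x - t)‖ := L.le_opNorm₂ _ _
      _ ≤ ‖L‖ * ‖φ t‖ * M := by
        gcongr
        exact ht
      _ = ‖L‖ * M * ‖φ t‖ := by ring
  | succ l ih =>
    have hφ1 : ContDiff ℝ 1 φ := hφ.of_le (by norm_cast; omega)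
    have hfd : fderiv ℝ (convolution φ w L μ) =
        convolution (fderiv ℝ φ) w (L.precompL G) μ :=
      funext fun y => (hc.hasFDerivAt_convolution_left L hφ1 hw y).fderiv
    rw [← norm_iteratedFDeriv_fderiv, hfd]
    have := ih (L.precompL G) (fderiv ℝ φ) (hc.fderiv ℝ)
      (hφ.fderiv_right (m := l) (by norm_cast))
    simp only [norm_iteratedFDeriv_fderiv] at this
    refine this.trans ?_
    gcongr
    exact L.norm_precompL_le G

theorem convol_eq_convolution (d : ℕ) (g f : EuclideanSpace ℝ (Fin d) → ℝ) :
    convol d g f = convolution g f (ContinuousLinearMap.mul ℝ ℝ) volume := by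
  funext t
  rw [convolution_mul_swap]
  rfl

theorem hasCompactSupport_resKer (d : ℕ) (K : EuclideanSpace ℝ (Fin d) → ℝ)
    (hc : HasCompactSupport K) (h : ℝ) (hh : 0 < h) : HasCompactSupport (resKer d K h) :=
  HasCompactSupport.mul_left (hc.comp_smul (inv_ne_zero hh.ne'))

theorem contDiff_resKer (d N : ℕ) (K : EuclideanSpace ℝ (Fin d) → ℝ) (hK : ContDiff ℝ N K)
    (h : ℝ) : ContDiff ℝ N (resKer d K h) :=
  contDiff_const.mul (hK.comp (contDiff_id.const_smul h⁻¹))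

theorem integral_norm_iteratedFDeriv_resKer (d l : ℕ) (K : EuclideanSpace ℝ (Fin d) → ℝ)
    (hK : ContDiff ℝ l K) (h : ℝ) (hh : 0 < h) :
    ∫ t, ‖iteratedFDeriv ℝ l (resKer d K h) t‖ =
      h⁻¹ ^ l * ∫ t, ‖iteratedFDeriv ℝ l K t‖ := by
  have hpt : ∀ t, ‖iteratedFDeriv ℝ l (resKer d K h) t‖ =
      (h ^ d)⁻¹ * (h⁻¹ ^ l * ‖iteratedFDeriv ℝ l K (h⁻¹ • t)‖) := by
    intro t
    have h1 : ContDiff ℝ l fun t => K (h⁻¹ • t) := hK.comp (contDiff_id.const_smul h⁻¹)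
    have h2 : resKer d K h = fun t => (h ^ d)⁻¹ • K (h⁻¹ • t) := rfl
    rw [h2, iteratedFDeriv_const_smul_apply' h1.contDiffAt, iteratedFDeriv_comp_const_smul _ hK,
      norm_smul, norm_smul, Real.norm_of_nonneg (by positivity), Real.norm_of_nonneg (by positivity)]
  simp_rw [hpt]
  rw [integral_const_mul, integral_const_mul, Measure.integral_comp_smul volume
    (fun t => ‖iteratedFDeriv ℝ l K t‖) h⁻¹, finrank_euclideanSpace, Fintype.card_fin,
    abs_of_pos (by positivity), smul_eq_mul, inv_pow, inv_pow, inv_inv]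
  field_simp

theorem norm_iteratedFDeriv_convol_resKer_le (d l : ℕ) (K : EuclideanSpace ℝ (Fin d) → ℝ)
    (hc : HasCompactSupport K) (hK : ContDiff ℝ l K) (h : ℝ) (hh : 0 < h)
    (w : EuclideanSpace ℝ (Fin d) → ℝ) (hw : LocallyIntegrable w) (M : ℝ) (hM : 0 ≤ M)
    (hwM : ∀ᵐ x, |w x| ≤ M) (x : EuclideanSpace ℝ (Fin d)) :
    ‖iteratedFDeriv ℝ l (convol d (resKer d K h) w) x‖ ≤
      M * h⁻¹ ^ l * ∫ t, ‖iteratedFDeriv ℝ l K t‖ := by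
  rw [convol_eq_convolution]
  have := norm_iteratedFDeriv_convolution_le volume w hw M hM hwM l (ContinuousLinearMap.mul ℝ ℝ)
    (resKer d K h) (hasCompactSupport_resKer d K hc h hh) (contDiff_resKer d l K hK h) x
  rw [integral_norm_iteratedFDeriv_resKer d l K hK h hh, ← mul_assoc] at this
  simpa using this

theorem contDiff_convol_resKer (d N : ℕ) (K : EuclideanSpace ℝ (Fin d) → ℝ)
    (hc : HasCompactSupport K) (hK : ContDiff ℝ N K) (h : ℝ) (hh : 0 < h)
    (w : EuclideanSpace ℝ (Fin d) → ℝ) (hw : LocallyIntegrable w) :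
    ContDiff ℝ N (convol d (resKer d K h) w) := by
  rw [convol_eq_convolution]
  exact (hasCompactSupport_resKer d K hc h hh).contDiff_convolution_left (n := N) _
    (contDiff_resKer d N K hK h) hw

theorem convol_left_comm (d : ℕ) (a b f : EuclideanSpace ℝ (Fin d) → ℝ)
    (hac : HasCompactSupport a) (ha : Continuous a) (hbc : HasCompactSupport b)
    (hb : Continuous b) (hf : LocallyIntegrable f) :
    convol d a (convol d b f) = convol d b (convol d a f) := by
  have assoc : ∀ a b : EuclideanSpace ℝ (Fin d) → ℝ, HasCompactSupport a → Continuous a →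
      HasCompactSupport b → Continuous b →
      convol d (convol d a b) f = convol d a (convol d b f) := by
    intro a b hac ha hbc hb
    simp only [convol_eq_convolution]
    funext x
    have hnorm : LocallyIntegrable (fun x => ‖f x‖) := fun x => (hf x).norm
    refine convolution_assoc _ _ _ _ (fun x y z => by simp [mul_assoc]) ha.aestronglyMeasurable
      hb.aestronglyMeasurable hf.aestronglyMeasurable ?_ ?_ ?_
    · exact Filter.Eventually.of_forall
        (hac.convolutionExists_left _ ha hb.locallyIntegrable)
    · exact Filter.Eventually.of_forall (hbc.norm.convolutionExists_left _ hb.norm hnorm)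
    · exact hac.norm.convolutionExists_left _ ha.norm
        (hbc.norm.continuous_convolution_left _ hb.norm hnorm).locallyIntegrable _
  have comm : convol d a b = convol d b a := by
    funext t
    unfold convol
    rw [← integral_sub_left_eq_self _ volume t]
    simp only [_root_.sub_sub_cancel, mul_comm]
  rw [← assoc a b hac ha hbc hb, ← assoc b a hbc hb hac ha, comm]

theorem convol_sub (d : ℕ) (a f g : EuclideanSpace ℝ (Fin d) → ℝ)
    (hac : HasCompactSupport a) (ha : Continuous a) (hf : LocallyIntegrable f)
    (hg : LocallyIntegrable g) :
    convol d a (f - g) = convol d a f - convol d a g := by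
  funext t
  have hi : ∀ w : EuclideanSpace ℝ (Fin d) → ℝ, LocallyIntegrable w →
      Integrable fun u => a (t - u) * w u := fun w hw =>
    convolutionExistsAt_iff_integrable_swap.1
      (hac.convolutionExists_left (ContinuousLinearMap.mul ℝ ℝ) ha hw t)
  simp only [convol, Pi.sub_apply, mul_sub]
  exact integral_sub (hi f hf) (hi g hg)

/-- Bernstein-type bound for the difference of two kernel smoothings of the same function. -/
theorem norm_iteratedFDeriv_convol_sub_le (d l : ℕ) (K : EuclideanSpace ℝ (Fin d) → ℝ)
    (hc : HasCompactSupport K) (hK : ContDiff ℝ l K) (h₁ h₂ : ℝ) (hh₁ : 0 < h₁) (hh₂ : 0 < h₂)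
    (f : EuclideanSpace ℝ (Fin d) → ℝ) (hf : LocallyIntegrable f) (M₁ M₂ : ℝ)
    (hM₁ : 0 ≤ M₁) (hM₂ : 0 ≤ M₂)
    (hf₁ : ∀ᵐ x, |convol d (resKer d K h₁) f x - f x| ≤ M₁)
    (hf₂ : ∀ᵐ x, |convol d (resKer d K h₂) f x - f x| ≤ M₂) (x : EuclideanSpace ℝ (Fin d)) :
    ‖iteratedFDeriv ℝ l (convol d (resKer d K h₂) f - convol d (resKer d K h₁) f) x‖ ≤
      (M₁ * h₂⁻¹ ^ l + M₂ * h₁⁻¹ ^ l) * ∫ t, ‖iteratedFDeriv ℝ l K t‖ := by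
  have hkc := fun h hh => hasCompactSupport_resKer d K hc h hh
  have hkk := fun h => (contDiff_resKer d l K hK h).continuous
  have hli : ∀ h, 0 < h → LocallyIntegrable (convol d (resKer d K h) f) := fun h hh =>
    (contDiff_convol_resKer d l K hc hK h hh f hf).continuous.locallyIntegrable
  have hdecomp : convol d (resKer d K h₂) f - convol d (resKer d K h₁) f =
      convol d (resKer d K h₁) (convol d (resKer d K h₂) f - f) -
        convol d (resKer d K h₂) (convol d (resKer d K h₁) f - f) := by
    rw [convol_sub d _ _ _ (hkc h₁ hh₁) (hkk h₁) (hli h₂ hh₂) hf,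
      convol_sub d _ _ _ (hkc h₂ hh₂) (hkk h₂) (hli h₁ hh₁) hf,
      convol_left_comm d _ _ f (hkc h₁ hh₁) (hkk h₁) (hkc h₂ hh₂) (hkk h₂) hf]
    abel
  rw [hdecomp, iteratedFDeriv_sub_apply
    (contDiff_convol_resKer d l K hc hK h₁ hh₁ _ ((hli h₂ hh₂).sub hf)).contDiffAt
    (contDiff_convol_resKer d l K hc hK h₂ hh₂ _ ((hli h₁ hh₁).sub hf)).contDiffAt]
  have e₁ := norm_iteratedFDeriv_convol_resKer_le d l K hc hK h₁ hh₁ _ ((hli h₂ hh₂).sub hf)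
    M₂ hM₂ hf₂ x
  have e₂ := norm_iteratedFDeriv_convol_resKer_le d l K hc hK h₂ hh₂ _ ((hli h₁ hh₁).sub hf)
    M₁ hM₁ hf₁ x
  refine (norm_sub_le _ _).trans ?_
  linarith

/-- A series whose terms decay like `2 ^ (-γ j)` and have Lipschitz constants growing like
`2 ^ ((1 - γ) j)` has a `γ`-Hölder sum. -/
theorem holder_tsum {E V : Type*} [NormedAddCommGroup E] [NormedAddCommGroup V] [CompleteSpace V]
    (γ : ℝ) (hγ₀ : 0 < γ) (hγ₁ : γ < 1) (Q : ℕ → E → V) (A B : ℝ)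
    (hA : ∀ j x, ‖Q j x‖ ≤ A * ((2 : ℝ) ^ (-γ)) ^ j)
    (hB : ∀ j x y, ‖Q j x - Q j y‖ ≤ B * ((2 : ℝ) ^ (1 - γ)) ^ j * ‖x - y‖) :
    ∃ C : ℝ, ∀ x y, ‖(∑' j, Q j x) - ∑' j, Q j y‖ ≤ C * ‖x - y‖ ^ γ := by
  set a : ℝ := (2 : ℝ) ^ (-γ) with ha
  set b : ℝ := (2 : ℝ) ^ (1 - γ) with hb
  have ha0 : 0 < a := by positivity
  have hb0 : 0 < b := by positivity
  have ha1 : a < 1 := Real.rpow_lt_one_of_one_lt_of_neg one_lt_two (by linarith)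
  have hb1 : 1 < b := Real.one_lt_rpow one_lt_two (by linarith)
  have hA0 : 0 ≤ A := by simpa using (norm_nonneg _).trans (hA 0 0)
  have hsum : ∀ x, Summable fun j => Q j x := fun x =>
    Summable.of_norm_bounded ((summable_geometric_of_lt_one ha0.le ha1).mul_left A) (hA · x)
  refine ⟨|B| * (b - 1)⁻¹ + 2 * A * (1 - a)⁻¹ * 2, fun x y => ?_⟩
  rcases eq_or_ne x y with rfl | hxy
  · simp [Real.zero_rpow hγ₀.ne']
  set δ := ‖x - y‖ with hδ
  have hδ0 : 0 < δ := norm_pos_iff.2 (sub_ne_zero.2 hxy)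
  obtain ⟨J, hJa, hJb⟩ : ∃ J : ℕ, a ^ J ≤ 2 * δ ^ γ ∧
      (∑ j ∈ Finset.range J, b ^ j) * δ ≤ (b - 1)⁻¹ * δ ^ γ := by
    rcases le_or_gt 1 δ with h1 | h1
    · have := Real.one_le_rpow h1 hγ₀.le
      refine ⟨0, by rw [pow_zero]; linarith, ?_⟩
      simp only [Finset.range_zero, Finset.sum_empty, zero_mul]
      have : 0 < b - 1 := by linarith
      positivity
    · obtain ⟨J, hJ1, hJ2⟩ := exists_nat_pow_near_of_lt_one hδ0 h1.le
        (by norm_num : (0 : ℝ) < 1 / 2) (by norm_num)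
      have hJ1' : (1 / 2 : ℝ) ^ J ≤ 2 * δ := by
        rw [pow_succ] at hJ1
        linarith
      refine ⟨J, ?_, ?_⟩
      · have e : a ^ J = ((1 / 2 : ℝ) ^ J) ^ γ := by
          rw [ha, ← Real.rpow_natCast, ← Real.rpow_mul (by norm_num), one_div, inv_pow,
            ← Real.rpow_natCast, ← Real.rpow_neg (by norm_num), ← Real.rpow_mul (by norm_num)]
          ring_nf
        rw [e]
        calc ((1 / 2 : ℝ) ^ J) ^ γ ≤ (2 * δ) ^ γ := by gcongr
          _ = 2 ^ γ * δ ^ γ := Real.mul_rpow (by norm_num) hδ0.le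
          _ ≤ 2 * δ ^ γ := by
            gcongr
            calc (2 : ℝ) ^ γ ≤ 2 ^ (1 : ℝ) :=
                  Real.rpow_le_rpow_of_exponent_le (by norm_num) hγ₁.le
              _ = 2 := Real.rpow_one 2
      · rw [geom_sum_eq hb1.ne']
        have e : b ^ J = ((2 : ℝ) ^ J) ^ (1 - γ) := by
          rw [hb, ← Real.rpow_natCast, ← Real.rpow_mul (by norm_num),
            ← Real.rpow_natCast, ← Real.rpow_mul (by norm_num)]
          ring_nf
        have h2J : (2 : ℝ) ^ J ≤ δ⁻¹ := by
          rw [le_inv_comm₀ (by positivity) hδ0]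
          simpa using hJ2
        have hbJ : b ^ J * δ ≤ δ ^ γ := by
          rw [e]
          calc ((2 : ℝ) ^ J) ^ (1 - γ) * δ ≤ (δ⁻¹) ^ (1 - γ) * δ := by
                gcongr
            _ = δ ^ (-(1 - γ)) * δ ^ (1 : ℝ) := by
                rw [Real.inv_rpow hδ0.le, Real.rpow_neg hδ0.le, Real.rpow_one]
            _ = δ ^ γ := by
                rw [← Real.rpow_add hδ0]
                ring_nf
        have hb2 : 0 < b - 1 := by linarith
        rw [div_eq_inv_mul, mul_assoc]
        gcongr
        rw [sub_mul, one_mul]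
        linarith
  rw [← (hsum x).tsum_sub (hsum y), ← ((hsum x).sub (hsum y)).sum_add_tsum_nat_add J]
  refine (norm_add_le _ _).trans ?_
  have hhead : ‖∑ j ∈ Finset.range J, (Q j x - Q j y)‖ ≤ |B| * (b - 1)⁻¹ * δ ^ γ := by
    calc _ ≤ ∑ j ∈ Finset.range J, |B| * b ^ j * δ := norm_sum_le_of_le _ fun j _ =>
          (hB j x y).trans (by gcongr; exact le_abs_self B)
      _ = |B| * ((∑ j ∈ Finset.range J, b ^ j) * δ) := by
          rw [Finset.sum_mul, Finset.mul_sum]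
          exact Finset.sum_congr rfl fun j _ => by ring
      _ ≤ |B| * ((b - 1)⁻¹ * δ ^ γ) := by gcongr
      _ = _ := by ring
  have htail : ‖∑' j, (Q (j + J) x - Q (j + J) y)‖ ≤ 2 * A * a ^ J * (1 - a)⁻¹ := by
    refine tsum_of_norm_bounded ((hasSum_geometric_of_lt_one ha0.le ha1).mul_left _) fun j => ?_
    have h1 := hA (j + J) x
    have h2 := hA (j + J) y
    have h3 := norm_sub_le (Q (j + J) x) (Q (j + J) y)
    rw [pow_add] at h1 h2
    nlinarith
  have ha2 : 0 < 1 - a := by linarith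
  have : 2 * A * a ^ J * (1 - a)⁻¹ ≤ 2 * A * (2 * δ ^ γ) * (1 - a)⁻¹ := by gcongr
  linarith

/-- A dyadic series with Bernstein-type bounds sums to a `C ^ m` function whose `m`-th derivative
is Hölder. -/
theorem contDiff_holder_tsum {E : Type*} [NormedAddCommGroup E] [NormedSpace ℝ E] (m : ℕ) (β : ℝ)
    (hm : (m : ℝ) < β) (hβ : β < m + 1) (P : ℕ → E → ℝ) (A : ℕ → ℝ)
    (hP : ∀ j, ContDiff ℝ (m + 1 : ℕ) (P j))
    (hA : ∀ l ≤ m + 1, ∀ j x, ‖iteratedFDeriv ℝ l (P j) x‖ ≤ A l * ((2 : ℝ) ^ ((l : ℝ) - β)) ^ j) :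
    ContDiff ℝ m (fun x => ∑' j, P j x) ∧ ∃ C : ℝ, ∀ x y,
      ‖iteratedFDeriv ℝ m (fun x => ∑' j, P j x) x - iteratedFDeriv ℝ m (fun x => ∑' j, P j x) y‖ ≤
        C * ‖x - y‖ ^ (β - m) := by
  have hP' : ∀ j, ContDiff ℝ m (P j) := fun j => (hP j).of_le (by norm_cast; omega)
  have hv : ∀ l : ℕ, (l : ℕ∞) ≤ (m : ℕ∞) →
      Summable fun j : ℕ => A l * ((2 : ℝ) ^ ((l : ℝ) - β)) ^ j := by
    intro l hl
    have hl' : (l : ℝ) ≤ m := by exact_mod_cast hl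
    exact (summable_geometric_of_lt_one (by positivity)
      (Real.rpow_lt_one_of_one_lt_of_neg one_lt_two (by linarith))).mul_left _
  have hb : ∀ (l j : ℕ) (x : E), (l : ℕ∞) ≤ (m : ℕ∞) →
      ‖iteratedFDeriv ℝ l (P j) x‖ ≤ A l * ((2 : ℝ) ^ ((l : ℝ) - β)) ^ j := by
    intro l j x hl
    have hl' : l ≤ m := by exact_mod_cast hl
    exact hA l (by omega) j x
  refine ⟨contDiff_tsum (N := (m : ℕ∞)) hP' hv hb, ?_⟩
  rw [iteratedFDeriv_tsum (N := (m : ℕ∞)) hP' hv hb le_rfl]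
  refine holder_tsum (β - m) (by linarith) (by linarith) (fun j => iteratedFDeriv ℝ m (P j))
    (A m) (A (m + 1)) (fun j x => ?_) (fun j x y => ?_)
  · rw [neg_sub]
    exact hA m (by omega) j x
  · refine Convex.norm_image_sub_le_of_norm_fderiv_le (𝕜 := ℝ) (s := Set.univ) (fun z _ => ?_)
      (fun z _ => ?_) convex_univ (Set.mem_univ y) (Set.mem_univ x)
    · exact (hP j).contDiffAt.differentiableAt_iteratedFDeriv (by norm_cast; omega)
    · rw [norm_fderiv_iteratedFDeriv]
      have := hA (m + 1) le_rfl j z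
      push_cast at this
      rwa [show (m : ℝ) + 1 - β = 1 - (β - m) by ring] at this

theorem ae_abs_le_of_supNorm_le (d : ℕ) (f : EuclideanSpace ℝ (Fin d) → ℝ) (c : ℝ) (hc : 0 ≤ c)
    (hf : supNorm d f ≤ ENNReal.ofReal c) : ∀ᵐ x, |f x| ≤ c := by
  unfold supNorm at hf
  rw [eLpNorm_exponent_top] at hf
  filter_upwards [ae_le_eLpNormEssSup (f := f) (μ := volume)] with x hx
  have := hx.trans hf
  rw [← ofReal_norm] at this
  exact (ENNReal.ofReal_le_ofReal_iff hc).1 this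

theorem exists_index_near (m : ℕ → ℕ) (hm : Filter.Tendsto m Filter.atTop Filter.atTop) (B : ℕ)
    (hB : ∀ n, m (n + 1) - m n ≤ B) (j : ℕ) :
    ∃ n, 1 ≤ n ∧ j ≤ m n ∧ m n ≤ j + (m 1 + B) := by
  classical
  have hex : ∃ n, 1 ≤ n ∧ j ≤ m n :=
    ((Filter.eventually_ge_atTop 1).and (hm.eventually_ge_atTop j)).exists
  obtain ⟨h1, h2⟩ := Nat.find_spec hex
  refine ⟨Nat.find hex, h1, h2, ?_⟩
  generalize hn : Nat.find hex = n at h1 h2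
  rcases n with _ | _ | n
  · omega
  · simp only [zero_add]
    omega
  · have := Nat.find_min hex (m := n + 1) (by omega)
    have := hB (n + 1)
    omega

/-- A bounded function approximated at rate `h ^ β` by its kernel smoothings agrees almost
everywhere with a Hölder function. -/
theorem exists_holderSigma_of_approx (d m : ℕ) (β : ℝ) (hm : (m : ℝ) < β) (hβ : β < m + 1)
    (K : EuclideanSpace ℝ (Fin d) → ℝ) (hc : HasCompactSupport K)
    (hK : ContDiff ℝ (m + 1 : ℕ) K) (h : ℕ → ℝ) (hh : BandClass h)
    (f : EuclideanSpace ℝ (Fin d) → ℝ) (hf : BddMeas d f) (hper : Per1 d f) (C : ℝ) (hC₀ : 0 ≤ C)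
    (hC : ∀ n : ℕ, 1 ≤ n → ∀ᵐ t, |convol d (resKer d K (h n)) f t - f t| ≤ C * h n ^ β) :
    ∃ g : EuclideanSpace ℝ (Fin d) → ℝ, HolderSigma d β g ∧ f =ᵐ[volume] g := by
  obtain ⟨e, -, -, he, ⟨B, hB⟩, hhe⟩ := hh
  obtain ⟨hfm, M, hM⟩ := hf
  have hM0 : 0 ≤ M := (abs_nonneg _).trans (hM 0)
  have hβ0 : 0 < β := lt_of_le_of_lt (Nat.cast_nonneg m) hm
  have hfli : LocallyIntegrable f volume :=
    (memLp_top_of_bound hfm.aestronglyMeasurable M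
      (Filter.Eventually.of_forall hM)).locallyIntegrable le_top
  choose ν hν1 hν2 hν3 using exists_index_near e he B hB
  set D := e 1 + B with hD
  let H : ℕ → ℝ := fun j => h (ν j)
  have hH0 : ∀ j, 0 < H j := fun j => by
    simp only [H, hhe]
    positivity
  have hHinv : ∀ j l : ℕ, (H j)⁻¹ ^ l ≤ ((2 : ℝ) ^ l) ^ (j + D) := by
    intro j l
    simp only [H, hhe]
    rw [Real.rpow_neg (by norm_num), inv_inv, Real.rpow_natCast, ← pow_mul, ← pow_mul]
    refine pow_le_pow_right₀ (by norm_num) ?_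
    rw [mul_comm]
    exact Nat.mul_le_mul_left l (hν3 j)
  have hHβ : ∀ j, H j ^ β ≤ ((2 : ℝ) ^ (-β)) ^ j := by
    intro j
    simp only [H, hhe]
    rw [← Real.rpow_natCast, ← Real.rpow_mul (by norm_num), ← Real.rpow_mul (by norm_num)]
    refine Real.rpow_le_rpow_of_exponent_le (by norm_num) ?_
    have : (j : ℝ) ≤ e (ν j) := by exact_mod_cast hν2 j
    nlinarith
  set a : ℝ := (2 : ℝ) ^ (-β) with ha
  have ha0 : 0 < a := by positivity
  have ha1 : a < 1 := Real.rpow_lt_one_of_one_lt_of_neg one_lt_two (by linarith)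
  let F : ℕ → EuclideanSpace ℝ (Fin d) → ℝ := fun j => convol d (resKer d K (H j)) f
  have hFf : ∀ j, ∀ᵐ t, |F j t - f t| ≤ C * a ^ j := by
    intro j
    filter_upwards [hC (ν j) (hν1 j)] with t ht
    exact ht.trans (mul_le_mul_of_nonneg_left (hHβ j) hC₀)
  let I : ℕ → ℝ := fun l => ∫ t, ‖iteratedFDeriv ℝ l K t‖
  have hI0 : ∀ l, 0 ≤ I l := fun l => integral_nonneg fun _ => norm_nonneg _
  let P : ℕ → EuclideanSpace ℝ (Fin d) → ℝ
    | 0 => F 0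
    | j + 1 => F (j + 1) - F j
  have hFc : ∀ j, ContDiff ℝ (m + 1 : ℕ) (F j) := fun j =>
    contDiff_convol_resKer d (m + 1) K hc hK _ (hH0 j) f hfli
  have hPc : ∀ j, ContDiff ℝ (m + 1 : ℕ) (P j) := by
    rintro (_ | j)
    · exact hFc 0
    · exact (hFc (j + 1)).sub (hFc j)
  have hPsum : ∀ n x, ∑ j ∈ Finset.range (n + 1), P j x = F n x := by
    intro n x
    induction n with
    | zero => simp [P]
    | succ n ih =>
      rw [Finset.sum_range_succ, ih]
      simp [P]
  let A : ℕ → ℝ := fun l => M * ((2 : ℝ) ^ l) ^ D * I l + 2 * C * a⁻¹ * ((2 : ℝ) ^ l) ^ D * I l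
  have hA : ∀ l ≤ m + 1, ∀ j x,
      ‖iteratedFDeriv ℝ l (P j) x‖ ≤ A l * ((2 : ℝ) ^ ((l : ℝ) - β)) ^ j := by
    intro l hl j x
    have hKl : ContDiff ℝ l K := hK.of_le (by exact_mod_cast hl)
    have hr : ((2 : ℝ) ^ ((l : ℝ) - β)) = 2 ^ l * a := by
      rw [ha, sub_eq_add_neg, Real.rpow_add (by norm_num), Real.rpow_natCast]
    rw [hr]
    have hI := hI0 l
    rcases j with _ | j
    · have h1 := norm_iteratedFDeriv_convol_resKer_le d l K hc hKl (H 0) (hH0 0) f hfli M hM0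
        (Filter.Eventually.of_forall hM) x
      have h2 := hHinv 0 l
      rw [zero_add] at h2
      calc _ ≤ M * (H 0)⁻¹ ^ l * I l := h1
        _ ≤ M * ((2 : ℝ) ^ l) ^ D * I l := by gcongr
        _ ≤ A l := le_add_of_nonneg_right (by positivity)
        _ = A l * (2 ^ l * a) ^ 0 := by simp
    · have h1 := norm_iteratedFDeriv_convol_sub_le d l K hc hKl (H j) (H (j + 1)) (hH0 j)
        (hH0 (j + 1)) f hfli (C * a ^ j) (C * a ^ (j + 1)) (by positivity) (by positivity)
        (hFf j) (hFf (j + 1)) x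
      have h2 := hHinv j l
      have h3 := hHinv (j + 1) l
      have h4 : ((2 : ℝ) ^ l) ^ (j + D) ≤ ((2 : ℝ) ^ l) ^ (j + 1 + D) :=
        pow_le_pow_right₀ (one_le_pow₀ (by norm_num)) (by omega)
      have h5 : a ^ (j + 1) ≤ a ^ j := pow_le_pow_of_le_one ha0.le ha1.le (by omega)
      have hH := (hH0 j).le
      calc _ ≤ (C * a ^ j * (H (j + 1))⁻¹ ^ l + C * a ^ (j + 1) * (H j)⁻¹ ^ l) * I l := h1
        _ ≤ (C * a ^ j * ((2 : ℝ) ^ l) ^ (j + 1 + D) +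
              C * a ^ j * ((2 : ℝ) ^ l) ^ (j + 1 + D)) * I l := by
            gcongr
            exact h2.trans h4
        _ = (2 * C * a⁻¹ * ((2 : ℝ) ^ l) ^ D * I l) * (2 ^ l * a) ^ (j + 1) := by
            rw [mul_pow, pow_add _ (j + 1) D, pow_succ a j]
            field_simp
            ring
        _ ≤ A l * (2 ^ l * a) ^ (j + 1) := by
            gcongr
            exact le_add_of_nonneg_left (by positivity)
  obtain ⟨hgc, Cg, hCg⟩ := contDiff_holder_tsum m β hm hβ P A hPc hA
  set g : EuclideanSpace ℝ (Fin d) → ℝ := fun x => ∑' j, P j x with hg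
  have hlim : ∀ x, Filter.Tendsto (fun n => F n x) Filter.atTop (nhds (g x)) := by
    intro x
    have hs : Summable fun j => P j x := by
      refine Summable.of_norm_bounded
        ((summable_geometric_of_lt_one ha0.le ha1).mul_left (A 0)) fun j => ?_
      have := hA 0 (by omega) j x
      simpa [← ha] using this
    have := (hs.hasSum.tendsto_sum_nat).comp (Filter.tendsto_add_atTop_nat 1)
    refine this.congr fun n => ?_
    exact hPsum n x
  have hae : f =ᵐ[volume] g := by
    filter_upwards [ae_all_iff.2 hFf] with x hx
    refine tendsto_nhds_unique ?_ (hlim x)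
    rw [tendsto_iff_norm_sub_tendsto_zero]
    refine squeeze_zero (fun _ => norm_nonneg _) hx ?_
    simpa using (tendsto_pow_atTop_nhds_zero_of_lt_one ha0.le ha1).const_mul C
  have hgper : Per1 d g := by
    intro x i
    refine tendsto_nhds_unique (hlim _) ((hlim x).congr fun n => ?_)
    simp only [F]
    rw [convol_resKer_eq d K f _ (hH0 n), convol_resKer_eq d K f _ (hH0 n)]
    congr 1
    funext v
    rw [add_sub_right_comm, hper]
  have hgbdd : ∃ M, ∀ x, |g x| ≤ M := by
    refine ⟨M * I 0, fun x => le_of_tendsto (hlim x).abs (Filter.Eventually.of_forall fun n => ?_)⟩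
    have := norm_iteratedFDeriv_convol_resKer_le d 0 K hc (hK.of_le (by simp)) (H n) (hH0 n) f
      hfli M hM0 (Filter.Eventually.of_forall hM) x
    simpa [F, I] using this
  refine ⟨g, ⟨m, hm, hβ.le, hgc, hgbdd, hgper, fun σ hσ => ?_⟩, hae⟩
  obtain ⟨r, hr⟩ := pderivM_eq_iteratedFDeriv d m σ hσ g hgc
  refine ⟨Cg, fun x y => ?_⟩
  rw [hr, hr, ← sub_apply]
  have := (iteratedFDeriv ℝ m g x - iteratedFDeriv ℝ m g y).le_opNorm
    (fun j => EuclideanSpace.single (r j) (1 : ℝ))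
  simp only [PiLp.norm_single, norm_one, Finset.prod_const_one, mul_one] at this
  exact this.trans (hCg x y)

/-- Deterministic content of case 1 of Theorem 4: for non-integer `β > 0`, `N = ⌈β⌉`,
`K ∈ K(N)` and `(h_n) ∈ H`, a bounded measurable 1-periodic `f` satisfies
`sup_n h_n^{-β} ‖K_{h_n} * f - f‖_∞ < ∞` iff `f` coincides almost everywhere with a function
of the Hölder class `Σ(β)`. -/
theorem kernel_approx_iff_holder (d : ℕ) (hd : 1 ≤ d) (β : ℝ) (hβ : 0 < β)
    (hβni : ∀ k : ℕ, β ≠ (k : ℝ))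
    (N : ℕ) (hN : β < (N : ℝ) ∧ (N : ℝ) ≤ β + 1)
    (K : EuclideanSpace ℝ (Fin d) → ℝ) (hK : KernelClass d N K)
    (h : ℕ → ℝ) (hh : BandClass h)
    (f : EuclideanSpace ℝ (Fin d) → ℝ) (hf : BddMeas d f) (hper : Per1 d f) :
    (∃ C : ℝ, ∀ n : ℕ, 1 ≤ n →
      supNorm d (fun t => convol d (resKer d K (h n)) f t - f t) ≤
        ENNReal.ofReal (C * h n ^ β)) ↔
    ∃ g : EuclideanSpace ℝ (Fin d) → ℝ, HolderSigma d β g ∧ f =ᵐ[volume] g := by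
  obtain ⟨hc, -, -, hmass, ⟨hK, -⟩, hmom⟩ := hK
  constructor
  · rintro ⟨C, hC⟩
    obtain ⟨m, rfl⟩ : ∃ m, N = m + 1 := Nat.exists_eq_succ_of_ne_zero (by
      rintro rfl
      have := hN.1
      norm_num at this
      linarith)
    push_cast at hN
    have hm : (m : ℝ) < β := lt_of_le_of_ne (by linarith [hN.2]) (hβni m).symm
    have hpos : ∀ n, 0 < h n := by
      obtain ⟨e, -, -, -, -, he⟩ := hh
      intro n
      rw [he]
      positivity
    refine exists_holderSigma_of_approx d m β hm hN.1 K hc hK h hh f hf hper |C| (abs_nonneg C)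
      fun n hn => ae_abs_le_of_supNorm_le d _ _ ?_ ((hC n hn).trans ?_)
    · have := hpos n
      positivity
    · have := hpos n
      exact ENNReal.ofReal_le_ofReal (by gcongr; exact le_abs_self C)
  · rintro ⟨g, ⟨m, hm, -, hg, -, -, hσ⟩, hfg⟩
    have hmN : m ≤ N := by
      have : (m : ℝ) < N := hm.trans hN.1
      exact_mod_cast this.le
    obtain ⟨C, hC⟩ := supNorm_convol_sub_le d N m hmN β hm K hc hK.continuous hmass hmom f g hfg
      hg hσ
    obtain ⟨e, -, -, -, -, he⟩ := hh
    refine ⟨C, fun n _ => hC (h n) ?_⟩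
    rw [he]
    positivity
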